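/- arXiv:2501.15361 — 3 statements merged into one kernel-verified Lean document; each statement's English description precedes it below -/
import Mathlib

section
/- (Lemma 7 of the appendix, A-part, pointwise form.) Let f : ℝ^{d₁×d₂} → ℝ be differentiable with L-Lipschitz gradient and uniformly bounded gradient ‖∇f(W)‖_F ≤ G for all W. Fix W₀ ∈ ℝ^{d₁×d₂}. Let A, A′ ∈ ℝ^{r×d₂} with ‖A‖_F ≤ C_A, ‖A′‖_F ≤ C_A, and B, B′ ∈ ℝ^{d₁×r} with ‖B‖_F ≤ C_B, ‖B′‖_F ≤ C_B. Then ‖Bᵀ∇f(W₀+BA) − B′ᵀ∇f(W₀+B′A′)‖_F² ≤ 4‖B − B′‖_F²·(G² + L²C_B²C_A²) + 2‖A − A′‖_F²·L²C_B⁴. -/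
open Matrix Finset

attribute [local instance] Matrix.frobeniusSeminormedAddCommGroup
  Matrix.frobeniusNormedAddCommGroup Matrix.frobeniusNormedSpace

/-- The Frobenius (trace) inner product of two real matrices. -/
noncomputable def frobInner {m n : Type*} [Fintype m] [Fintype n]
    (M N : Matrix m n ℝ) : ℝ :=
  ∑ i, ∑ j, M i j * N i j

/-- The Frobenius inner product with a fixed matrix `M`, as a continuous linear map. -/
noncomputable def frobInnerCLM {m n : Type*} [Fintype m] [Fintype n]
    (M : Matrix m n ℝ) : Matrix m n ℝ →L[ℝ] ℝ :=
  LinearMap.toContinuousLinearMap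
    { toFun := fun N => frobInner M N
      map_add' := by
        intro N₁ N₂
        simp [frobInner, Matrix.add_apply, mul_add, Finset.sum_add_distrib]
      map_smul' := by
        intro c N
        simp only [frobInner, Matrix.smul_apply, smul_eq_mul, RingHom.id_apply]
        rw [Finset.mul_sum]
        refine Finset.sum_congr rfl fun i _ => ?_
        rw [Finset.mul_sum]
        exact Finset.sum_congr rfl fun j _ => by ring }

/-- Lemma 7 (appendix), A-part, pointwise form. -/
theorem statement_6 {d₁ d₂ r : ℕ}
    (f : Matrix (Fin d₁) (Fin d₂) ℝ → ℝ)
    (gradf : Matrix (Fin d₁) (Fin d₂) ℝ → Matrix (Fin d₁) (Fin d₂) ℝ)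
    (L G C_A C_B : ℝ)
    (hdiff : ∀ W, HasFDerivAt f (frobInnerCLM (gradf W)) W)
    (hlip : ∀ W W', ‖gradf W - gradf W'‖ ≤ L * ‖W - W'‖)
    (hbdd : ∀ W, ‖gradf W‖ ≤ G)
    (W₀ : Matrix (Fin d₁) (Fin d₂) ℝ)
    (A A' : Matrix (Fin r) (Fin d₂) ℝ) (hA : ‖A‖ ≤ C_A) (hA' : ‖A'‖ ≤ C_A)
    (B B' : Matrix (Fin d₁) (Fin r) ℝ) (hB : ‖B‖ ≤ C_B) (hB' : ‖B'‖ ≤ C_B) :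
    ‖Bᵀ * gradf (W₀ + B * A) - B'ᵀ * gradf (W₀ + B' * A')‖ ^ 2
      ≤ 4 * ‖B - B'‖ ^ 2 * (G ^ 2 + L ^ 2 * C_B ^ 2 * C_A ^ 2)
        + 2 * ‖A - A'‖ ^ 2 * L ^ 2 * C_B ^ 4 := by
  set W := W₀ + B * A
  set W' := W₀ + B' * A'
  have hCB : 0 ≤ C_B := (norm_nonneg B).trans hB
  have hW : ‖W - W'‖ ≤ C_B * ‖A - A'‖ + ‖B - B'‖ * C_A := by
    have h : W - W' = B * (A - A') + (B - B') * A' := by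
      simp only [W, W', Matrix.mul_sub, Matrix.sub_mul]
      abel
    rw [h]
    refine (norm_add_le _ _).trans (add_le_add ?_ ?_)
    · exact (frobenius_norm_mul _ _).trans (by gcongr)
    · exact (frobenius_norm_mul _ _).trans (by gcongr)
  have hgrad : ‖gradf W - gradf W'‖ ≤ |L| * (C_B * ‖A - A'‖ + ‖B - B'‖ * C_A) :=
    (hlip W W').trans <|
      (mul_le_mul_of_nonneg_right (le_abs_self L) (norm_nonneg _)).trans (by gcongr)
  have hD : ‖Bᵀ * gradf W - B'ᵀ * gradf W'‖
      ≤ ‖B - B'‖ * G + C_B * (|L| * (C_B * ‖A - A'‖ + ‖B - B'‖ * C_A)) := by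
    have h : Bᵀ * gradf W - B'ᵀ * gradf W'
        = (B - B')ᵀ * gradf W + B'ᵀ * (gradf W - gradf W') := by
      rw [Matrix.transpose_sub, Matrix.sub_mul, Matrix.mul_sub]
      abel
    rw [h]
    refine (norm_add_le _ _).trans (add_le_add ?_ ?_)
    · refine (frobenius_norm_mul _ _).trans ?_
      rw [frobenius_norm_transpose]
      exact mul_le_mul_of_nonneg_left (hbdd W) (norm_nonneg _)
    · refine (frobenius_norm_mul _ _).trans ?_
      rw [frobenius_norm_transpose]
      exact mul_le_mul hB' hgrad (norm_nonneg _) hCB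
  calc ‖Bᵀ * gradf W - B'ᵀ * gradf W'‖ ^ 2
      ≤ (‖B - B'‖ * G + C_B * (|L| * (C_B * ‖A - A'‖ + ‖B - B'‖ * C_A))) ^ 2 :=
        pow_le_pow_left₀ (norm_nonneg _) hD 2
    _ ≤ 4 * ‖B - B'‖ ^ 2 * (G ^ 2 + |L| ^ 2 * C_B ^ 2 * C_A ^ 2)
        + 2 * ‖A - A'‖ ^ 2 * |L| ^ 2 * C_B ^ 4 := by
      linarith [sq_nonneg (‖B - B'‖ * G - ‖B - B'‖ * |L| * C_B * C_A),
        sq_nonneg (‖B - B'‖ * G + ‖B - B'‖ * |L| * C_B * C_A - ‖A - A'‖ * |L| * C_B ^ 2)]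
    _ = _ := by rw [sq_abs]
end

section
/- (Lemma 7 of the appendix, B-part, pointwise form.) Let f : ℝ^{d₁×d₂} → ℝ be differentiable with L-Lipschitz gradient and uniformly bounded gradient ‖∇f(W)‖_F ≤ G for all W. Fix W₀ ∈ ℝ^{d₁×d₂}. Let A, A′ ∈ ℝ^{r×d₂} with ‖A‖_F ≤ C_A, ‖A′‖_F ≤ C_A, and B, B′ ∈ ℝ^{d₁×r} with ‖B‖_F ≤ C_B, ‖B′‖_F ≤ C_B. Then ‖∇f(W₀+BA)·Aᵀ − ∇f(W₀+B′A′)·A′ᵀ‖_F² ≤ 4‖A − A′‖_F²·(G² + L²C_B²C_A²) + 2‖B − B′‖_F²·L²C_A⁴. -/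
open Matrix Finset

attribute [local instance] Matrix.frobeniusSeminormedAddCommGroup
  Matrix.frobeniusNormedAddCommGroup Matrix.frobeniusNormedSpace

/-- The difference of two products is controlled by the differences of the factors. -/
theorem frobenius_norm_mul_sub_mul_le {l m n : Type*} [Fintype l] [Fintype m] [Fintype n]
    (M M' : Matrix l m ℝ) (N N' : Matrix m n ℝ) :
    ‖M * N - M' * N'‖ ≤ ‖M - M'‖ * ‖N‖ + ‖M'‖ * ‖N - N'‖ := by
  have h : M * N - M' * N' = (M - M') * N + M' * (N - N') := by
    rw [Matrix.sub_mul, Matrix.mul_sub]; abel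
  rw [h]
  exact (norm_add_le _ _).trans
    (add_le_add (Matrix.frobenius_norm_mul _ _) (Matrix.frobenius_norm_mul _ _))

/-- Lemma 7 (appendix), B-part, pointwise form. -/
theorem statement_7 {d₁ d₂ r : ℕ}
    (f : Matrix (Fin d₁) (Fin d₂) ℝ → ℝ)
    (gradf : Matrix (Fin d₁) (Fin d₂) ℝ → Matrix (Fin d₁) (Fin d₂) ℝ)
    (L G C_A C_B : ℝ)
    (hdiff : ∀ W, HasFDerivAt f (frobInnerCLM (gradf W)) W)
    (hlip : ∀ W W', ‖gradf W - gradf W'‖ ≤ L * ‖W - W'‖)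
    (hbdd : ∀ W, ‖gradf W‖ ≤ G)
    (W₀ : Matrix (Fin d₁) (Fin d₂) ℝ)
    (A A' : Matrix (Fin r) (Fin d₂) ℝ) (hA : ‖A‖ ≤ C_A) (hA' : ‖A'‖ ≤ C_A)
    (B B' : Matrix (Fin d₁) (Fin r) ℝ) (hB : ‖B‖ ≤ C_B) (hB' : ‖B'‖ ≤ C_B) :
    ‖gradf (W₀ + B * A) * Aᵀ - gradf (W₀ + B' * A') * A'ᵀ‖ ^ 2
      ≤ 4 * ‖A - A'‖ ^ 2 * (G ^ 2 + L ^ 2 * C_B ^ 2 * C_A ^ 2)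
        + 2 * ‖B - B'‖ ^ 2 * L ^ 2 * C_A ^ 4 := by
  have hCA : 0 ≤ C_A := (norm_nonneg A).trans hA
  have hprod : ‖B * A - B' * A'‖ ≤ ‖B - B'‖ * C_A + C_B * ‖A - A'‖ :=
    (frobenius_norm_mul_sub_mul_le B B' A A').trans (by gcongr)
  have hgrad : ‖gradf (W₀ + B * A) - gradf (W₀ + B' * A')‖
      ≤ |L| * (‖B - B'‖ * C_A + C_B * ‖A - A'‖) := by
    calc _ ≤ L * ‖B * A - B' * A'‖ := by
          simpa only [add_sub_add_left_eq_sub] using hlip (W₀ + B * A) (W₀ + B' * A')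
      _ ≤ |L| * ‖B * A - B' * A'‖ := by gcongr; exact le_abs_self L
      _ ≤ _ := by gcongr
  have hmain : ‖gradf (W₀ + B * A) * Aᵀ - gradf (W₀ + B' * A') * A'ᵀ‖
      ≤ |L| * (‖B - B'‖ * C_A + C_B * ‖A - A'‖) * C_A + G * ‖A - A'‖ := by
    refine (frobenius_norm_mul_sub_mul_le _ _ _ _).trans ?_
    rw [← Matrix.transpose_sub, Matrix.frobenius_norm_transpose, Matrix.frobenius_norm_transpose]
    have hG := hbdd (W₀ + B' * A')
    have hgrad_nonneg := (norm_nonneg _).trans hgrad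
    gcongr
  set a := ‖A - A'‖
  set b := ‖B - B'‖
  calc _ ≤ (|L| * (b * C_A + C_B * a) * C_A + G * a) ^ 2 := by gcongr
    _ ≤ 4 * a ^ 2 * (G ^ 2 + |L| ^ 2 * C_B ^ 2 * C_A ^ 2) + 2 * b ^ 2 * |L| ^ 2 * C_A ^ 4 := by
        linear_combination sq_nonneg (|L| * b * C_A ^ 2 - (|L| * C_B * C_A * a + G * a))
          + 2 * sq_nonneg (|L| * C_B * C_A * a - G * a)
    _ = _ := by rw [sq_abs]
end

section
/- (Consensus-error-to-gradient-error bound, A-part; deterministic core of Lemma 3.) Let f₁,…,fₙ : ℝ^{d₁×d₂} → ℝ each be differentiable with L-Lipschitz gradient and ‖∇f_i(W)‖_F ≤ G for all W and all i. Fix W₀ ∈ ℝ^{d₁×d₂}. Let A₁,…,Aₙ ∈ ℝ^{r×d₂} and B₁,…,Bₙ ∈ ℝ^{d₁×r} with ‖A_i‖_F ≤ C_A and ‖B_i‖_F ≤ C_B for all i, and let Ā = (1/n)∑_i A_i, B̄ = (1/n)∑_i B_i, which also satisfy ‖Ā‖_F ≤ C_A and ‖B̄‖_F ≤ C_B. Then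 ‖(1/n)∑_{i=1}^n (B_iᵀ∇f_i(W₀+B_iA_i) − B̄ᵀ∇f_i(W₀+B̄Ā))‖_F² ≤ (8(G² + L²C_B²C_A²)/n)·∑_{i=1}^n ‖B_i − B̄‖_F² + (4L²C_B⁴/n)·∑_{i=1}^n ‖A_i − Ā‖_F². -/
open Matrix Finset

attribute [local instance] Matrix.frobeniusSeminormedAddCommGroup
  Matrix.frobeniusNormedAddCommGroup Matrix.frobeniusNormedSpace

/-- The squared norm of an average is at most the average of the squared norms. -/
theorem norm_sq_average_le {E : Type*} [SeminormedAddCommGroup E] [NormedSpace ℝ E] {n : ℕ}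
    (hn : 1 ≤ n) (x : Fin n → E) :
    ‖(n : ℝ)⁻¹ • ∑ i, x i‖ ^ 2 ≤ (n : ℝ)⁻¹ * ∑ i, ‖x i‖ ^ 2 := by
  have hn' : (0 : ℝ) < n := by exact_mod_cast hn
  rw [norm_smul, mul_pow, Real.norm_of_nonneg (inv_nonneg.2 hn'.le)]
  have h : ‖∑ i, x i‖ ^ 2 ≤ n * ∑ i, ‖x i‖ ^ 2 := by
    calc ‖∑ i, x i‖ ^ 2 ≤ (∑ i, ‖x i‖) ^ 2 := by gcongr; exact norm_sum_le _ _
      _ ≤ n * ∑ i, ‖x i‖ ^ 2 := by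
        simpa using sq_sum_le_card_mul_sum_sq (s := univ) (f := fun i => ‖x i‖)
  calc ((n : ℝ)⁻¹) ^ 2 * ‖∑ i, x i‖ ^ 2 ≤ ((n : ℝ)⁻¹) ^ 2 * (n * ∑ i, ‖x i‖ ^ 2) := by gcongr
    _ = (n : ℝ)⁻¹ * ∑ i, ‖x i‖ ^ 2 := by field_simp

/-- Change of the `A`-gradient `Bᵀ * g (W₀ + B * A)` when both low-rank factors are perturbed. -/
theorem norm_sq_factorGradient_sub_le {l m k : Type*} [Fintype l] [Fintype m] [Fintype k]
    (g : Matrix l m ℝ → Matrix l m ℝ) {L G a b : ℝ}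
    (hlip : ∀ W W', ‖g W - g W'‖ ≤ L * ‖W - W'‖) (hbdd : ∀ W, ‖g W‖ ≤ G)
    (W₀ : Matrix l m ℝ) (A A' : Matrix k m ℝ) (B B' : Matrix l k ℝ)
    (hB : ‖B‖ ≤ b) (hA' : ‖A'‖ ≤ a) (hB' : ‖B'‖ ≤ b) :
    ‖Bᵀ * g (W₀ + B * A) - B'ᵀ * g (W₀ + B' * A')‖ ^ 2
      ≤ 8 * (G ^ 2 + L ^ 2 * b ^ 2 * a ^ 2) * ‖B - B'‖ ^ 2
        + 4 * L ^ 2 * b ^ 4 * ‖A - A'‖ ^ 2 := by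
  have hb : 0 ≤ b := (norm_nonneg _).trans hB
  have hprod : ‖B * A - B' * A'‖ ≤ b * ‖A - A'‖ + ‖B - B'‖ * a := by
    have e : B * A - B' * A' = B * (A - A') + (B - B') * A' := by
      rw [Matrix.mul_sub, Matrix.sub_mul]; abel
    rw [e]
    refine (norm_add_le _ _).trans (add_le_add ?_ ?_)
    · exact (frobenius_norm_mul _ _).trans (by gcongr)
    · exact (frobenius_norm_mul _ _).trans (by gcongr)
  have hgrad : ‖g (W₀ + B * A) - g (W₀ + B' * A')‖ ≤ |L| * (b * ‖A - A'‖ + ‖B - B'‖ * a) := by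
    refine (hlip _ _).trans ?_
    rw [add_sub_add_left_eq_sub]
    exact mul_le_mul (le_abs_self L) hprod (norm_nonneg _) (abs_nonneg L)
  have key : ‖Bᵀ * g (W₀ + B * A) - B'ᵀ * g (W₀ + B' * A')‖
      ≤ ‖B - B'‖ * G + b * (|L| * (b * ‖A - A'‖ + ‖B - B'‖ * a)) := by
    have e : Bᵀ * g (W₀ + B * A) - B'ᵀ * g (W₀ + B' * A')
        = (B - B')ᵀ * g (W₀ + B * A) + B'ᵀ * (g (W₀ + B * A) - g (W₀ + B' * A')) := by
      rw [Matrix.mul_sub, Matrix.transpose_sub, Matrix.sub_mul]; abel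
    rw [e]
    refine (norm_add_le _ _).trans (add_le_add ?_ ?_)
    · refine (frobenius_norm_mul _ _).trans ?_
      rw [frobenius_norm_transpose]
      exact mul_le_mul_of_nonneg_left (hbdd _) (norm_nonneg _)
    · refine (frobenius_norm_mul _ _).trans ?_
      rw [frobenius_norm_transpose]
      exact mul_le_mul hB' hgrad (norm_nonneg _) hb
  have split (x y z : ℝ) : (x + y + z) ^ 2 ≤ 8 * x ^ 2 + 8 * y ^ 2 + 4 * z ^ 2 := by
    nlinarith [sq_nonneg (x - y), sq_nonneg (x - z), sq_nonneg (y - z), sq_nonneg x,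
      sq_nonneg y, sq_nonneg z]
  calc _ ≤ (‖B - B'‖ * G + b * (|L| * (b * ‖A - A'‖ + ‖B - B'‖ * a))) ^ 2 := by gcongr
    _ = (‖B - B'‖ * G + |L| * b * a * ‖B - B'‖ + |L| * b ^ 2 * ‖A - A'‖) ^ 2 := by ring
    _ ≤ _ := split _ _ _
    _ = _ := by simp only [mul_pow, sq_abs]; ring

/-- consensus-error-to-gradient-error bound, A-part (deterministic core of
Lemma 3). -/
theorem statement_13 {d₁ d₂ r n : ℕ} (hn : 1 ≤ n)
    (f : Fin n → Matrix (Fin d₁) (Fin d₂) ℝ → ℝ)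
    (gradf : Fin n → Matrix (Fin d₁) (Fin d₂) ℝ → Matrix (Fin d₁) (Fin d₂) ℝ)
    (L G C_A C_B : ℝ)
    (hdiff : ∀ i W, HasFDerivAt (f i) (frobInnerCLM (gradf i W)) W)
    (hlip : ∀ i W W', ‖gradf i W - gradf i W'‖ ≤ L * ‖W - W'‖)
    (hbdd : ∀ i W, ‖gradf i W‖ ≤ G)
    (W₀ : Matrix (Fin d₁) (Fin d₂) ℝ)
    (A : Fin n → Matrix (Fin r) (Fin d₂) ℝ) (B : Fin n → Matrix (Fin d₁) (Fin r) ℝ)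
    (hA : ∀ i, ‖A i‖ ≤ C_A) (hB : ∀ i, ‖B i‖ ≤ C_B)
    (Abar : Matrix (Fin r) (Fin d₂) ℝ) (Bbar : Matrix (Fin d₁) (Fin r) ℝ)
    (hAbar : Abar = (n : ℝ)⁻¹ • ∑ i, A i) (hBbar : Bbar = (n : ℝ)⁻¹ • ∑ i, B i)
    (hAbarN : ‖Abar‖ ≤ C_A) (hBbarN : ‖Bbar‖ ≤ C_B) :
    ‖(n : ℝ)⁻¹ • ∑ i, ((B i)ᵀ * gradf i (W₀ + B i * A i) - Bbarᵀ * gradf i (W₀ + Bbar * Abar))‖ ^ 2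
      ≤ 8 * (G ^ 2 + L ^ 2 * C_B ^ 2 * C_A ^ 2) / (n : ℝ) * ∑ i, ‖B i - Bbar‖ ^ 2
        + 4 * L ^ 2 * C_B ^ 4 / (n : ℝ) * ∑ i, ‖A i - Abar‖ ^ 2 := by
  refine (norm_sq_average_le hn _).trans ?_
  calc _ ≤ (n : ℝ)⁻¹ * ∑ i, (8 * (G ^ 2 + L ^ 2 * C_B ^ 2 * C_A ^ 2) * ‖B i - Bbar‖ ^ 2
        + 4 * L ^ 2 * C_B ^ 4 * ‖A i - Abar‖ ^ 2) := by
        refine mul_le_mul_of_nonneg_left (sum_le_sum fun i _ => ?_) (by positivity)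
        exact norm_sq_factorGradient_sub_le (gradf i) (hlip i) (hbdd i) W₀ (A i) Abar (B i) Bbar
          (hB i) hAbarN hBbarN
    _ = _ := by
        rw [sum_add_distrib, ← mul_sum, ← mul_sum]
        ring
end
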